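/- arXiv:1807.05112 — 3 statements merged into one kernel-verified Lean document; each statement's English description precedes it below -/
import Mathlib

section
/- In the randomized rounding scheme applied to a fractional schedule x̄_1,…,x̄_T, the expected operating cost of the random integral schedule equals the operating cost of the fractional schedule under the linearly interpolated cost functions: E[Σ_{t=1}^T f_t(x_t)] = Σ_{t=1}^T f̄_t(x̄_t), where f̄_t(x) = (⌈x⌉ − x)·f_t(⌊x⌋) + (x − ⌊x⌋)·f_t(⌈x⌉). -/
open Finset MeasureTheory

noncomputable section

/-- `frac x = x − ⌊x⌋`. -/
def fr (x : ℝ) : ℝ := x - (⌊x⌋₊ : ℝ)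

/-- `x̄'_{t−1}`: the projection of the previous fractional state `x̄_{t−1}` into the
interval `[⌊x̄_t⌋, ⌈x̄_t⌉]`. -/
def projPrev (xbar : ℕ → ℝ) (t : ℕ) : ℝ :=
  max (⌊xbar t⌋₊ : ℝ) (min ((⌈xbar t⌉₊ : ℝ)) (xbar (t - 1)))

/-- `p↑_t = (x̄_t − x̄'_{t−1}) / (1 − frac(x̄'_{t−1}))`, where the fractional part of
`x̄'_{t−1}` is taken relative to the interval `[⌊x̄_t⌋, ⌈x̄_t⌉]`, i.e. it equals
`x̄'_{t−1} − ⌊x̄_t⌋` (this coincides with `x̄'_{t−1} − ⌊x̄'_{t−1}⌋` except at the right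
endpoint of the interval). -/
def pUp (xbar : ℕ → ℝ) (t : ℕ) : ℝ :=
  (xbar t - projPrev xbar t) / (1 - (projPrev xbar t - (⌊xbar t⌋₊ : ℝ)))

/-- `p↓_t = (x̄'_{t−1} − x̄_t) / frac(x̄'_{t−1})`, with the fractional part of
`x̄'_{t−1}` taken relative to the interval `[⌊x̄_t⌋, ⌈x̄_t⌉]` as in `pUp`. -/
def pDown (xbar : ℕ → ℝ) (t : ℕ) : ℝ :=
  (projPrev xbar t - xbar t) / (projPrev xbar t - (⌊xbar t⌋₊ : ℝ))

/-- Linear interpolation of `f : ℕ → ℝ` to real arguments: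
`f̄(x) = (⌈x⌉ − x)·f(⌊x⌋) + (x − ⌊x⌋)·f(⌈x⌉)` (and `f̄(x) = f(x)` at integers). -/
def interp (f : ℕ → ℝ) (x : ℝ) : ℝ :=
  (1 - (x - (⌊x⌋₊ : ℝ))) * f ⌊x⌋₊ + (x - (⌊x⌋₊ : ℝ)) * f (⌊x⌋₊ + 1)

/-- If `Z = a` whenever `Y = a`, and otherwise `Z = a` with conditional probability `p`, then
`P(Z = a) = P(Y = a) + p (1 - P(Y = a))`. -/
lemma measureReal_eq_of_keep {Ω : Type*} [MeasurableSpace Ω] (μ : Measure Ω)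
    [IsProbabilityMeasure μ] {Y Z : Ω → ℕ} (hY : Measurable Y) (a : ℕ) (p : ℝ)
    (hkeep : ∀ ω, Y ω = a → Z ω = a)
    (hprob : (μ {ω | Y ω ≠ a ∧ Z ω = a}).toReal = p * (μ {ω | Y ω ≠ a}).toReal) :
    μ.real {ω | Z ω = a} = μ.real {ω | Y ω = a} + p * (1 - μ.real {ω | Y ω = a}) := by
  have hYa : MeasurableSet {ω | Y ω = a} := hY (measurableSet_singleton a)
  have hinter : {ω | Z ω = a} ∩ {ω | Y ω = a} = {ω | Y ω = a} := by
    ext ω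
    simpa using hkeep ω
  have hdiff : {ω | Z ω = a} \ {ω | Y ω = a} = {ω | Y ω ≠ a ∧ Z ω = a} := by
    ext ω
    simp [and_comm]
  have hcompl : {ω | Y ω = a}ᶜ = {ω | Y ω ≠ a} := rfl
  rw [← measureReal_inter_add_sdiff (μ := μ) (s := {ω | Z ω = a}) hYa, hinter, hdiff,
    ← probReal_compl_eq_one_sub hYa, hcompl]
  exact congrArg _ hprob

/-- If `Z` takes only the values `a ≠ b`, the probabilities of these values sum to one. -/
lemma measureReal_eq_one_sub {Ω : Type*} [MeasurableSpace Ω] (μ : Measure Ω)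
    [IsProbabilityMeasure μ] {Z : Ω → ℕ} (hZ : Measurable Z) {a b : ℕ} (hab : a ≠ b)
    (hrange : ∀ ω, Z ω = a ∨ Z ω = b) :
    μ.real {ω | Z ω = b} = 1 - μ.real {ω | Z ω = a} := by
  have hZa : MeasurableSet {ω | Z ω = a} := hZ (measurableSet_singleton a)
  rw [← probReal_compl_eq_one_sub hZa]
  congr 1
  ext ω
  rcases hrange ω with h | h <;> simp [h, hab, hab.symm]

/-- `Z` rounds `x` to `⌊x⌋` or `⌈x⌉`, with mean `x`. -/
structure IsRounding {Ω : Type*} [MeasurableSpace Ω] (μ : Measure Ω) (Z : Ω → ℕ) (x : ℝ) :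
    Prop where
  nonneg : 0 ≤ x
  range : ∀ ω, Z ω = ⌊x⌋₊ ∨ Z ω = ⌈x⌉₊
  prob : μ.real {ω | Z ω = ⌊x⌋₊} = 1 - fr x

lemma ceil_eq_floor_add_one {x : ℝ} (hx : 0 ≤ x) (h : (⌊x⌋₊ : ℝ) ≠ x) : ⌈x⌉₊ = ⌊x⌋₊ + 1 := by
  have h1 := lt_of_le_of_ne (Nat.floor_le hx) h
  rw [Nat.ceil_eq_iff (by omega)]
  push_cast
  exact ⟨by simpa using h1, (Nat.lt_floor_add_one x).le⟩

lemma ceil_eq_floor {x : ℝ} (h : (⌊x⌋₊ : ℝ) = x) : ⌈x⌉₊ = ⌊x⌋₊ := by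
  conv_lhs => rw [← h]
  exact Nat.ceil_natCast _

namespace IsRounding

variable {Ω : Type*} [MeasurableSpace Ω] {μ : Measure Ω} {Y Z : Ω → ℕ} {x y : ℝ}

/-- The probability of the lower value, phrased for an interval `[n, n + 1)` containing `y`. -/
lemma prob_floor (hY : IsRounding μ Y y) {n : ℕ} (hn : (n : ℝ) ≤ y) (hn' : y < n + 1) :
    μ.real {ω | Y ω = n} = 1 - (y - n) := by
  have hfl : ⌊y⌋₊ = n := (Nat.floor_eq_iff hY.nonneg).2 ⟨hn, hn'⟩
  simpa [fr, hfl] using hY.prob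

lemma le_of_le (hY : IsRounding μ Y y) {n : ℕ} (h : y ≤ n) (ω : Ω) : Y ω ≤ n := by
  rcases hY.range ω with h' | h' <;> rw [h']
  · exact Nat.floor_le_of_le h
  · exact Nat.ceil_le.2 h

lemma le_of_ge (hY : IsRounding μ Y y) {n : ℕ} (h : (n : ℝ) ≤ y) (ω : Ω) : n ≤ Y ω := by
  rcases hY.range ω with h' | h' <;> rw [h']
  · exact Nat.le_floor h
  · exact_mod_cast h.trans (Nat.le_ceil y)

variable [IsProbabilityMeasure μ]

lemma of_integer (hx : 0 ≤ x) (h : (⌊x⌋₊ : ℝ) = x) (hrange : ∀ ω, Z ω = ⌊x⌋₊ ∨ Z ω = ⌈x⌉₊) :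
    IsRounding μ Z x := by
  refine ⟨hx, hrange, ?_⟩
  have hset : {ω | Z ω = ⌊x⌋₊} = Set.univ := by
    ext ω
    simpa [ceil_eq_floor h] using hrange ω
  simp [hset, fr, h]

/-- The probability of the upper value, phrased for an interval `[n, n + 1]` containing `y`. -/
lemma prob_succ (hY : IsRounding μ Y y) (hm : Measurable Y) {n : ℕ} (hn : (n : ℝ) ≤ y)
    (hn' : y ≤ n + 1) : μ.real {ω | Y ω = n + 1} = y - n := by
  rcases hn'.eq_or_lt with rfl | hlt
  · have hfl : ⌊(n : ℝ) + 1⌋₊ = n + 1 := by exact_mod_cast Nat.floor_natCast (n + 1)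
    have := hY.prob
    rw [hfl] at this
    rw [this, fr, hfl]
    push_cast
    ring
  · have hfl : ⌊y⌋₊ = n := (Nat.floor_eq_iff hY.nonneg).2 ⟨hn, hlt⟩
    rcases hn.eq_or_lt with heq | hgt
    · have hset : {ω | Y ω = n + 1} = ∅ := by
        ext ω
        have hr := hY.range ω
        rw [ceil_eq_floor (by rw [hfl, heq]), hfl] at hr
        simp
        omega
      simp [hset, heq]
    · have hr := hY.range
      rw [ceil_eq_floor_add_one hY.nonneg (by rw [hfl]; exact hgt.ne), hfl] at hr
      have hp := hY.prob
      rw [hfl, fr, hfl] at hp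
      rw [measureReal_eq_one_sub μ hm (Nat.succ_ne_self n).symm hr, hp]
      ring

lemma integral_comp (hZ : IsRounding μ Z x) (hm : Measurable Z) (g : ℕ → ℝ) :
    Integrable (fun ω => g (Z ω)) μ ∧ ∫ ω, g (Z ω) ∂μ = interp g x := by
  by_cases h : (⌊x⌋₊ : ℝ) = x
  · have hr := hZ.range
    rw [ceil_eq_floor h] at hr
    have hc : (fun ω => g (Z ω)) = fun _ => g ⌊x⌋₊ := by
      funext ω
      rcases hr ω with h' | h' <;> rw [h']
    rw [hc]
    exact ⟨integrable_const _, by simp [interp, h]⟩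
  · have hr := hZ.range
    rw [ceil_eq_floor_add_one hZ.nonneg h] at hr
    have hma : MeasurableSet {ω | Z ω = ⌊x⌋₊} := hm (measurableSet_singleton _)
    have hmb : MeasurableSet {ω | Z ω = ⌊x⌋₊ + 1} := hm (measurableSet_singleton _)
    have hc : (fun ω => g (Z ω)) = fun ω =>
        {ω | Z ω = ⌊x⌋₊}.indicator (fun _ => g ⌊x⌋₊) ω +
          {ω | Z ω = ⌊x⌋₊ + 1}.indicator (fun _ => g (⌊x⌋₊ + 1)) ω := by
      funext ω
      rcases hr ω with h' | h' <;> simp [Set.indicator, h']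
    have hia := (integrable_const (μ := μ) (g ⌊x⌋₊)).indicator hma
    have hib := (integrable_const (μ := μ) (g (⌊x⌋₊ + 1))).indicator hmb
    rw [hc]
    refine ⟨hia.add hib, ?_⟩
    rw [integral_add hia hib, integral_indicator_const _ hma, integral_indicator_const _ hmb,
      measureReal_eq_one_sub μ hm (Nat.succ_ne_self _).symm hr, hZ.prob]
    simp only [smul_eq_mul, interp, fr]
    ring

end IsRounding

/-- One step of the rounding scheme preserves the marginals. -/
lemma isRounding_step {Ω : Type*} [MeasurableSpace Ω] {μ : Measure Ω} [IsProbabilityMeasure μ]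
    {xbar : ℕ → ℝ} {t : ℕ} {Y Z : Ω → ℕ} (hY : IsRounding μ Y (xbar (t - 1)))
    (hYm : Measurable Y) (hZm : Measurable Z) (hx : 0 ≤ xbar t)
    (hrange : ∀ ω, Z ω = ⌊xbar t⌋₊ ∨ Z ω = ⌈xbar t⌉₊)
    (hkeepUp : xbar (t - 1) ≤ xbar t → ∀ ω, Y ω = ⌈xbar t⌉₊ → Z ω = ⌈xbar t⌉₊)
    (hprobUp : xbar (t - 1) ≤ xbar t → (⌊xbar t⌋₊ : ℝ) ≠ xbar t →
      (μ {ω | Y ω ≠ ⌈xbar t⌉₊ ∧ Z ω = ⌈xbar t⌉₊}).toReal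
        = pUp xbar t * (μ {ω | Y ω ≠ ⌈xbar t⌉₊}).toReal)
    (hkeepDown : xbar t < xbar (t - 1) → ∀ ω, Y ω = ⌊xbar t⌋₊ → Z ω = ⌊xbar t⌋₊)
    (hprobDown : xbar t < xbar (t - 1) → (⌊xbar t⌋₊ : ℝ) ≠ xbar t →
      (μ {ω | Y ω ≠ ⌊xbar t⌋₊ ∧ Z ω = ⌊xbar t⌋₊}).toReal
        = pDown xbar t * (μ {ω | Y ω ≠ ⌊xbar t⌋₊}).toReal) :
    IsRounding μ Z (xbar t) := by
  by_cases h : (⌊xbar t⌋₊ : ℝ) = xbar t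
  · exact .of_integer hx h hrange
  refine ⟨hx, hrange, ?_⟩
  have hceil := ceil_eq_floor_add_one hx h
  have hlt := Nat.lt_floor_add_one (xbar t)
  have hgt := lt_of_le_of_ne (Nat.floor_le hx) h
  rw [hceil] at hrange hkeepUp hprobUp
  simp only [pUp, pDown, projPrev, hceil, fr] at *
  push_cast at *
  generalize ⌊xbar t⌋₊ = n at *
  rcases le_or_gt (xbar (t - 1)) (xbar t) with hle | hle
  · have key := measureReal_eq_of_keep μ hYm _ _ (hkeepUp hle) (hprobUp hle h)
    rw [measureReal_eq_one_sub μ hZm (Nat.succ_ne_self n).symm hrange,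
      min_eq_right (hle.trans hlt.le)] at key
    rcases le_total (n : ℝ) (xbar (t - 1)) with hn | hn
    · rw [hY.prob_succ hYm hn (hle.trans hlt.le), max_eq_right hn,
        div_mul_cancel₀ _ (by linarith)] at key
      linarith
    · have hset : {ω | Y ω = n + 1} = ∅ := by
        ext ω
        have := hY.le_of_le hn ω
        simp
        omega
      rw [hset, max_eq_left hn] at key
      simp at key
      linarith
  · have key := measureReal_eq_of_keep μ hYm _ _ (hkeepDown hle) (hprobDown hle h)
    rcases lt_or_ge (xbar (t - 1)) (n + 1) with hn | hn
    · have hn' : (n : ℝ) ≤ xbar (t - 1) := (hgt.trans hle).le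
      rw [hY.prob_floor hn' hn, min_eq_right hn.le, max_eq_right hn', sub_sub_cancel,
        div_mul_cancel₀ _ (by linarith)] at key
      linarith
    · have hset : {ω | Y ω = n} = ∅ := by
        ext ω
        have := hY.le_of_ge (n := n + 1) (by exact_mod_cast hn) ω
        simp
        omega
      rw [hset, min_eq_left hn, max_eq_right (by linarith)] at key
      simp at key
      linarith

/-- In the randomized rounding scheme applied to a fractional
schedule `x̄_1,…,x̄_T`, the expected operating cost of the random integral schedule
equals the operating cost of the fractional schedule under the linearly interpolated
cost functions: `E[∑_{t=1}^T f_t(x_t)] = ∑_{t=1}^T f̄_t(x̄_t)`. -/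
theorem stmt15 {Ω : Type*} [MeasurableSpace Ω]
    (μ : Measure Ω) [IsProbabilityMeasure μ]
    (T m : ℕ) (f : ℕ → ℕ → ℝ)
    (xbar : ℕ → ℝ) (hx0 : xbar 0 = 0)
    (hxm : ∀ t ∈ Finset.Icc 1 T, xbar t ∈ Set.Icc (0 : ℝ) m)
    (X : ℕ → Ω → ℕ) (hX0 : ∀ ω, X 0 ω = 0) (hmeas : ∀ t, Measurable (X t))
    (hrange : ∀ t ∈ Finset.Icc 1 T, ∀ ω, X t ω = ⌊xbar t⌋₊ ∨ X t ω = ⌈xbar t⌉₊)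
    (hkeepUp : ∀ t ∈ Finset.Icc 1 T, xbar (t - 1) ≤ xbar t →
      ∀ ω, X (t - 1) ω = ⌈xbar t⌉₊ → X t ω = ⌈xbar t⌉₊)
    (hprobUp : ∀ t ∈ Finset.Icc 1 T, xbar (t - 1) ≤ xbar t →
      (⌊xbar t⌋₊ : ℝ) ≠ xbar t →
      (μ {ω | X (t - 1) ω ≠ ⌈xbar t⌉₊ ∧ X t ω = ⌈xbar t⌉₊}).toReal
        = pUp xbar t * (μ {ω | X (t - 1) ω ≠ ⌈xbar t⌉₊}).toReal)
    (hkeepDown : ∀ t ∈ Finset.Icc 1 T, xbar t < xbar (t - 1) →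
      ∀ ω, X (t - 1) ω = ⌊xbar t⌋₊ → X t ω = ⌊xbar t⌋₊)
    (hprobDown : ∀ t ∈ Finset.Icc 1 T, xbar t < xbar (t - 1) →
      (⌊xbar t⌋₊ : ℝ) ≠ xbar t →
      (μ {ω | X (t - 1) ω ≠ ⌊xbar t⌋₊ ∧ X t ω = ⌊xbar t⌋₊}).toReal
        = pDown xbar t * (μ {ω | X (t - 1) ω ≠ ⌊xbar t⌋₊}).toReal) :
    ∫ ω, (∑ t ∈ Finset.Icc 1 T, f t (X t ω)) ∂μ
      = ∑ t ∈ Finset.Icc 1 T, interp (f t) (xbar t) := by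
  have hround : ∀ t ≤ T, IsRounding μ (X t) (xbar t) := by
    intro t
    induction t with
    | zero => exact fun _ => .of_integer hx0.ge (by simp [hx0]) (by simp [hX0, hx0])
    | succ t ih =>
      intro ht
      have hmem : t + 1 ∈ Finset.Icc 1 T := Finset.mem_Icc.2 ⟨by omega, ht⟩
      exact isRounding_step (ih (by omega)) (hmeas t) (hmeas (t + 1)) (hxm _ hmem).1
        (hrange _ hmem) (hkeepUp _ hmem) (hprobUp _ hmem) (hkeepDown _ hmem) (hprobDown _ hmem)
  have hint : ∀ t ∈ Finset.Icc 1 T, Integrable (fun ω => f t (X t ω)) μ ∧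
      ∫ ω, f t (X t ω) ∂μ = interp (f t) (xbar t) := fun t ht =>
    (hround t (Finset.mem_Icc.1 ht).2).integral_comp (hmeas t) (f t)
  rw [integral_finsetSum _ fun t ht => (hint t ht).1]
  exact Finset.sum_congr rfl fun t ht => (hint t ht).2
end
end

section
/- There is no deterministic online algorithm with competitive ratio less than 3 for the discrete data-center optimization problem. Precisely: for every deterministic online algorithm A (a map assigning to each finite sequence of revealed cost functions f_1,…,f_t a state x^A_t ∈ {0,1}), every constant c < 3 and every constant α ≥ 0, there exist a time horizon T ∈ ℕ, a switching constant β = 2, and convex nonnegative cost functions f_1,…,f_T on {0,1} (each of the form x ↦ ε·|x| or x ↦ ε·|1 − x| for some ε > 0) such that the schedule X^A produced by A satisfies C(X^A) > c·C(X*) + α, where X* is an optimal schedule for the instance. -/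
open Finset

noncomputable section

/-- Feasible discrete schedules for the lower-bound instances (`m = 1` server):
states in `{0,1}`, starting and ending in state `0`. -/
def Feasible17 (T : ℕ) (x : ℕ → ℕ) : Prop :=
  x 0 = 0 ∧ x (T + 1) = 0 ∧ ∀ t, x t ≤ 1

/-- Total cost with switching constant `β = 2`, charged for both powering up and
powering down: `C(X) = ∑_{t=1}^T f_t(x_t) + (β/2)·∑_{t=1}^{T+1} |x_t − x_{t−1}|`. -/
def Cost17 (T : ℕ) (f : ℕ → ℝ → ℝ) (x : ℕ → ℕ) : ℝ :=
  ∑ t ∈ Finset.Icc 1 T, f t (x t)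
    + (2 / 2) * ∑ t ∈ Finset.Icc 1 (T + 1), |(x t : ℝ) - (x (t - 1) : ℝ)|

/-- The adversary's penalty of size `ε` for staying in the state `s`. -/
def stayPenalty (ε : ℝ) (s : ℕ) : ℝ → ℝ :=
  if s = 0 then fun x => ε * |1 - x| else fun x => ε * |x|

theorem stayPenalty_nonneg {ε : ℝ} (hε : 0 ≤ ε) (s : ℕ) (x : ℝ) : 0 ≤ stayPenalty ε s x := by
  unfold stayPenalty
  split_ifs <;> positivity

theorem stayPenalty_apply (ε : ℝ) {s x : ℕ} (hs : s ≤ 1) (hx : x ≤ 1) :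
    stayPenalty ε s x = ε * (1 - |(x : ℝ) - s|) := by
  interval_cases s <;> interval_cases x <;> simp [stayPenalty]

/-- The cost functions revealed up to time `n` when the adversary always penalizes the
previous state of the algorithm `A`, together with the state of `A` at time `n`. -/
def play (A : List (ℝ → ℝ) → ℕ) (ε : ℝ) : ℕ → List (ℝ → ℝ) × ℕ
  | 0 => ([], 0)
  | n + 1 =>
    let l := (play A ε n).1 ++ [stayPenalty ε (play A ε n).2]
    (l, A l)

theorem play_fst (A : List (ℝ → ℝ) → ℕ) (ε : ℝ) (n : ℕ) :
    (play A ε n).1 = (List.range n).map fun i => stayPenalty ε (play A ε i).2 := by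
  induction n with
  | zero => rfl
  | succ n ih => simp [play, List.range_succ, ih]

theorem play_snd_le_one {A : List (ℝ → ℝ) → ℕ} (hA : ∀ l, A l ≤ 1) (ε : ℝ) (n : ℕ) :
    (play A ε n).2 ≤ 1 := by
  cases n with
  | zero => exact Nat.zero_le _
  | succ n => exact hA _

theorem Cost17_nonneg {T : ℕ} {f : ℕ → ℝ → ℝ} (hf : ∀ t x, 0 ≤ f t x) (x : ℕ → ℕ) :
    0 ≤ Cost17 T f x := by
  unfold Cost17
  have h₁ := Finset.sum_nonneg fun t (_ : t ∈ Finset.Icc 1 T) => hf t (x t)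
  positivity

/-- Switching cost of `x` up to time `T`. -/
def switching (T : ℕ) (x : ℕ → ℕ) : ℝ :=
  ∑ t ∈ Finset.Icc 1 T, |(x t : ℝ) - (x (t - 1) : ℝ)|

theorem switching_succ (T : ℕ) (x : ℕ → ℕ) :
    switching (T + 1) x = switching T x + |(x (T + 1) : ℝ) - x T| := by
  simp [switching, Finset.sum_Icc_succ_top]

theorem switching_nonneg (T : ℕ) (x : ℕ → ℕ) : 0 ≤ switching T x :=
  Finset.sum_nonneg fun _ _ => abs_nonneg _

theorem Cost17_eq (T : ℕ) (f : ℕ → ℝ → ℝ) (x : ℕ → ℕ) :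
    Cost17 T f x = ∑ t ∈ Finset.Icc 1 T, f t (x t) + switching (T + 1) x := by
  simp [Cost17, switching]

theorem abs_natCast_sub_le_one {a b : ℕ} (ha : a ≤ 1) (hb : b ≤ 1) : |(a : ℝ) - b| ≤ 1 := by
  interval_cases a <;> interval_cases b <;> norm_num

/-- Forcing a `{0,1}`-valued sequence to start and end in state `0` costs at most two
extra switches. -/
theorem exists_feasible_cost_le (T : ℕ) (f : ℕ → ℝ → ℝ) {g : ℕ → ℕ} (hg : ∀ t, g t ≤ 1) :
    ∃ y, Feasible17 T y ∧
      Cost17 T f y ≤ ∑ t ∈ Finset.Icc 1 T, f t (g t) + switching T g + 2 := by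
  set y : ℕ → ℕ := fun t => if t ∈ Finset.Icc 1 T then g t else 0 with hy
  have hy_mem : ∀ t ∈ Finset.Icc 1 T, y t = g t := fun t ht => if_pos ht
  have hy_le : ∀ t, y t ≤ 1 := fun t => by
    simp only [hy]
    split_ifs
    exacts [hg t, zero_le_one]
  refine ⟨y, ⟨by simp [hy], by simp [hy], hy_le⟩, ?_⟩
  have hsum : ∑ t ∈ Finset.Icc 1 T, f t (y t) = ∑ t ∈ Finset.Icc 1 T, f t (g t) :=
    Finset.sum_congr rfl fun t ht => by rw [hy_mem t ht]
  have hswitch : ∀ n ≤ T, switching n y ≤ switching n g + 1 := by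
    intro n hn
    induction n with
    | zero => simp [switching]
    | succ n ih =>
      rcases Nat.eq_zero_or_pos n with rfl | hpos
      · have h₁ := abs_natCast_sub_le_one (hy_le 1) (hy_le 0)
        rw [switching_succ 0 y]
        have h₂ := switching_nonneg 1 g
        have h₃ : switching 0 y = 0 := by simp [switching]
        rw [h₃, zero_add, zero_add]
        linarith
      · rw [switching_succ, switching_succ, hy_mem (n + 1) (by simp; omega),
          hy_mem n (by simp; omega)]
        linarith [ih (by omega)]
  rw [Cost17_eq, hsum, switching_succ]
  linarith [hswitch T le_rfl, abs_natCast_sub_le_one (hy_le (T + 1)) (hy_le T)]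

theorem switching_delayed_complement_le (T : ℕ) {s : ℕ → ℕ} (hs : ∀ t, s t ≤ 1) :
    switching T (fun t => 1 - s (t - 1)) ≤ switching T s := by
  suffices h : switching T (fun t => 1 - s (t - 1)) + |(s T : ℝ) - s (T - 1)| = switching T s by
    linarith [abs_nonneg ((s T : ℝ) - s (T - 1))]
  induction T with
  | zero => simp [switching]
  | succ n ih =>
    rw [switching_succ, switching_succ, ← ih]
    simp only [Nat.add_sub_cancel, Nat.cast_sub (hs _)]
    rw [sub_sub_sub_cancel_left, abs_sub_comm]

theorem sum_stayPenalty_eq (ε : ℝ) (T : ℕ) {s : ℕ → ℕ} (hs : ∀ t, s t ≤ 1) :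
    ∑ t ∈ Finset.Icc 1 T, stayPenalty ε (s (t - 1)) (s t) = ε * (T - switching T s) := by
  simp [stayPenalty_apply ε (hs _) (hs _), switching, ← Finset.mul_sum]

/-- Any schedule at least as good as all feasible ones costs, up to an additive constant, at
most a third of `ε * T` plus the number of switches of the sequence the adversary reacts to. -/
theorem three_mul_cost_le (ε : ℝ) (T : ℕ) {s : ℕ → ℕ} (hs : ∀ t, s t ≤ 1) {x : ℕ → ℕ}
    (hx : ∀ y, Feasible17 T y →
      Cost17 T (fun t => stayPenalty ε (s (t - 1))) x ≤
        Cost17 T (fun t => stayPenalty ε (s (t - 1))) y) :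
    3 * Cost17 T (fun t => stayPenalty ε (s (t - 1))) x ≤ ε * T + switching T s + 6 := by
  have key : ∀ g : ℕ → ℕ, (∀ t, g t ≤ 1) → Cost17 T (fun t => stayPenalty ε (s (t - 1))) x ≤
      ∑ t ∈ Finset.Icc 1 T, stayPenalty ε (s (t - 1)) (g t) + switching T g + 2 := by
    intro g hg
    obtain ⟨y, hy, hle⟩ := exists_feasible_cost_le T (fun t => stayPenalty ε (s (t - 1))) hg
    exact (hx y hy).trans hle
  have h₀ := key (fun _ => 0) fun _ => zero_le_one
  have h₁ := key (fun _ => 1) fun _ => le_rfl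
  have h₂ := key (fun t => 1 - s (t - 1)) fun _ => Nat.sub_le _ _
  have hconst : ∑ t ∈ Finset.Icc 1 T, stayPenalty ε (s (t - 1)) ((0 : ℕ) : ℝ) +
      ∑ t ∈ Finset.Icc 1 T, stayPenalty ε (s (t - 1)) ((1 : ℕ) : ℝ) = ε * T := by
    rw [← Finset.sum_add_distrib, Finset.sum_congr rfl (g := fun _ => ε)]
    · simp [mul_comm]
    · intro t _
      unfold stayPenalty
      split_ifs <;> simp
  have hzero : ∑ t ∈ Finset.Icc 1 T, stayPenalty ε (s (t - 1)) ((1 - s (t - 1) : ℕ) : ℝ) = 0 := by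
    refine Finset.sum_eq_zero fun t _ => ?_
    have := hs (t - 1)
    interval_cases s (t - 1) <;> simp [stayPenalty]
  have hswitch₀ : switching T (fun _ => 0) = 0 := by simp [switching]
  have hswitch₁ : switching T (fun _ => 1) = 0 := by simp [switching]
  have hswitch₂ := switching_delayed_complement_le T hs
  rw [hswitch₀] at h₀
  rw [hswitch₁] at h₁
  rw [hzero] at h₂
  linarith

/-- No deterministic online algorithm has competitive ratio `< 3`
for the discrete data-center optimization problem: for every deterministic online
algorithm `A` (mapping the list of revealed cost functions to a state in `{0,1}`),
every `c < 3` and every `α ≥ 0` there is an instance, built from functions of the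
form `x ↦ ε·|x|` and `x ↦ ε·|1 − x|`, on which the schedule `X^A` produced by `A`
(where `x^A_t = A [f_1, …, f_t]`) satisfies `C(X^A) > c·C(X*) + α` for every optimal
schedule `X*`. -/
theorem stmt17 (A : List (ℝ → ℝ) → ℕ) (hA : ∀ l, A l ≤ 1)
    (c : ℝ) (hc : c < 3) (α : ℝ) (hα : 0 ≤ α) :
    ∃ (T : ℕ) (f : ℕ → ℝ → ℝ),
      (∀ t ∈ Finset.Icc 1 T, ∃ ε : ℝ, 0 < ε ∧
        ((f t = fun x => ε * |x|) ∨ (f t = fun x => ε * |1 - x|))) ∧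
      ∀ xA : ℕ → ℕ,
        (xA 0 = 0 ∧ xA (T + 1) = 0 ∧
          ∀ t ∈ Finset.Icc 1 T,
            xA t = A ((List.range t).map fun i => f (i + 1))) →
        ∀ xstar : ℕ → ℕ, Feasible17 T xstar →
          (∀ y : ℕ → ℕ, Feasible17 T y → Cost17 T f xstar ≤ Cost17 T f y) →
          c * Cost17 T f xstar + α < Cost17 T f xA := by
  set c' := max c 0 with hc'
  have hc'0 : 0 ≤ c' := le_max_right _ _
  have hc'3 : c' < 3 := max_lt hc (by norm_num)
  set ε := (3 - c') / 12 with hε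
  have hε0 : 0 < ε := by linarith
  obtain ⟨T, hT⟩ := exists_nat_gt ((6 + α) / (2 * ε * ε))
  rw [div_lt_iff₀ (by positivity)] at hT
  set s : ℕ → ℕ := fun n => (play A ε n).2 with hs
  have hs1 : ∀ t, s t ≤ 1 := play_snd_le_one hA ε
  refine ⟨T, fun t => stayPenalty ε (s (t - 1)), fun t _ => ⟨ε, hε0, ?_⟩, ?_⟩
  · dsimp only [stayPenalty]
    split_ifs
    exacts [Or.inr rfl, Or.inl rfl]
  rintro xA ⟨hxA0, -, hxA⟩ xstar - hopt
  have hxs : ∀ t ≤ T, xA t = s t := by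
    intro t ht
    cases t with
    | zero => exact hxA0
    | succ n =>
      rw [hxA _ (by simp; omega)]
      simp only [Nat.add_sub_cancel, hs]
      rw [← play_fst]
      rfl
  have hcostA : ε * (T - switching T s) + switching T s ≤
      Cost17 T (fun t => stayPenalty ε (s (t - 1))) xA := by
    have hswitch : switching T xA = switching T s := Finset.sum_congr rfl fun t ht => by
      rw [Finset.mem_Icc] at ht
      rw [hxs t ht.2, hxs (t - 1) (by omega)]
    have hsum : ∑ t ∈ Finset.Icc 1 T, stayPenalty ε (s (t - 1)) (xA t) =
        ε * (T - switching T s) := by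
      rw [← sum_stayPenalty_eq ε T hs1]
      exact Finset.sum_congr rfl fun t ht => by rw [hxs t (Finset.mem_Icc.1 ht).2]
    rw [Cost17_eq, switching_succ, hsum, hswitch]
    linarith [abs_nonneg ((xA (T + 1) : ℝ) - xA T)]
  have hcost := three_mul_cost_le ε T hs1 hopt
  have hnonneg : 0 ≤ Cost17 T (fun t => stayPenalty ε (s (t - 1))) xstar :=
    Cost17_nonneg (fun t x => stayPenalty_nonneg hε0.le _ x) xstar
  have hS := switching_nonneg T s
  have hcc' := mul_le_mul_of_nonneg_right (le_max_left c 0) hnonneg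
  rw [← hc'] at hcc'
  have hc'cost := mul_le_mul_of_nonneg_left hcost hc'0
  have hc'eq : c' = 3 - 12 * ε := by rw [hε]; ring
  rw [hc'eq] at hc'cost hcc' hc'0
  have hεS := mul_nonneg hε0.le hS
  have hεT : 0 ≤ ε * ε * T := by positivity
  nlinarith
end
end

section
/- There is no deterministic online algorithm with competitive ratio less than 2 for the continuous data-center optimization problem. Precisely: for every deterministic online algorithm A (a map assigning to each finite sequence of revealed cost functions f_1,…,f_t a state x^A_t ∈ [0,1]), every constant c < 2 and every constant α ≥ 0, there exist a time horizon T ∈ ℕ, a switching constant β = 2, and convex nonnegative cost functions f_1,…,f_T on [0,1] (each of the form x ↦ ε·|x| or x ↦ ε·|1 − x| for some ε > 0) such that the schedule X^A produced by A satisfies C(X^A) > c·C(X*) + α, where X* is an optimal fractional schedule for the instance. -/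
open Finset

noncomputable section

/-- Feasible fractional schedules for the lower-bound instances (`m = 1` server):
states in `[0,1]`, starting and ending in state `0`. -/
def Feasible18 (T : ℕ) (x : ℕ → ℝ) : Prop :=
  x 0 = 0 ∧ x (T + 1) = 0 ∧ ∀ t, x t ∈ Set.Icc (0 : ℝ) 1

/-- Total cost with switching constant `β = 2`, charged for both powering up and
powering down: `C(X) = ∑_{t=1}^T f_t(x_t) + (β/2)·∑_{t=1}^{T+1} |x_t − x_{t−1}|`. -/
def Cost18 (T : ℕ) (f : ℕ → ℝ → ℝ) (x : ℕ → ℝ) : ℝ :=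
  ∑ t ∈ Finset.Icc 1 T, f t (x t)
    + (2 / 2) * ∑ t ∈ Finset.Icc 1 (T + 1), |x t - x (t - 1)|

/-- Some schedule in `[0,1]` serves `f 1, …, f t` from state `0` and then moves to `x`, at total
cost at most `v`. -/
def Reachable (f : ℕ → ℝ → ℝ) (t : ℕ) (x v : ℝ) : Prop :=
  ∃ y : ℕ → ℝ, y 0 = 0 ∧ y (t + 1) = x ∧ (∀ i, y i ∈ Set.Icc (0 : ℝ) 1) ∧
    ∑ i ∈ Finset.Icc 1 t, f i (y i) + ∑ i ∈ Finset.Icc 1 (t + 1), |y i - y (i - 1)| ≤ v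

theorem Reachable.zero {f : ℕ → ℝ → ℝ} {x : ℝ} (hx : x ∈ Set.Icc (0 : ℝ) 1) :
    Reachable f 0 x x := by
  refine ⟨fun i => if i = 0 then 0 else x, by simp, by simp, fun i => ?_, ?_⟩
  · by_cases hi : i = 0 <;> simp [hi, hx.1, hx.2]
  · simp [abs_of_nonneg hx.1]

theorem Reachable.succ {f : ℕ → ℝ → ℝ} {t : ℕ} {x v : ℝ} (h : Reachable f t x v) {x' v' : ℝ}
    (hx' : x' ∈ Set.Icc (0 : ℝ) 1) (hv : v + f (t + 1) x + |x' - x| ≤ v') :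
    Reachable f (t + 1) x' v' := by
  obtain ⟨y, hy0, hyt, hy, hyv⟩ := h
  refine ⟨fun i => if i ≤ t + 1 then y i else x', by simp [hy0], by simp, fun i => ?_, ?_⟩
  · dsimp only
    split_ifs
    exacts [hy i, hx']
  · have h₁ : ∑ i ∈ Finset.Icc 1 (t + 1), f i (if i ≤ t + 1 then y i else x')
        = ∑ i ∈ Finset.Icc 1 (t + 1), f i (y i) :=
      Finset.sum_congr rfl fun i hi => by rw [if_pos (Finset.mem_Icc.1 hi).2]
    have h₂ : ∑ i ∈ Finset.Icc 1 (t + 1),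
          |(if i ≤ t + 1 then y i else x') - (if i - 1 ≤ t + 1 then y (i - 1) else x')|
        = ∑ i ∈ Finset.Icc 1 (t + 1), |y i - y (i - 1)| :=
      Finset.sum_congr rfl fun i hi => by
        have := (Finset.mem_Icc.1 hi).2
        rw [if_pos this, if_pos (by omega)]
    rw [Finset.sum_Icc_succ_top (by omega : 1 ≤ t + 1 + 1), h₁, h₂,
      Finset.sum_Icc_succ_top (by omega : 1 ≤ t + 1)]
    simp only [Nat.add_sub_cancel, le_refl, if_true, hyt,
      if_neg (by omega : ¬ t + 1 + 1 ≤ t + 1)]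
    linarith

/-- Amortized lower bound on the cost of one request `2h·|1 - x|`, for an algorithm moving
from `a` to `a'` while the reference point moves from `b` to `min 1 (b + h)`. -/
theorem amortized_step {h a a' b : ℝ} (h0 : 0 < h) (h4 : h ≤ 1 / 4)
    (ha' : a' ∈ Set.Icc (0 : ℝ) 1) (hb : b ∈ Set.Icc (0 : ℝ) 1)
    (hab : a ≤ b + h ^ 2 * (1 - 2 * b)) :
    (2 - 6 * h) * |min 1 (b + h) - b| + h ^ 3 ≤
      2 * h * |1 - a'| + |a' - a| + (1 - 2 * h) * (|a' - min 1 (b + h)| - |a - b|)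
        + ((min 1 (b + h) ^ 2 - min 1 (b + h)) - (b ^ 2 - b)) := by
  obtain ⟨hb0, hb1⟩ := hb
  obtain ⟨d, hd⟩ : ∃ d, d = min 1 (b + h) - b := ⟨_, rfl⟩
  have hbd : min 1 (b + h) = b + d := by linarith
  have hd0 : 0 ≤ d := by
    have : b ≤ min 1 (b + h) := le_min hb1 (by linarith)
    linarith
  have hdh : d ≤ h := by linarith [min_le_right 1 (b + h)]
  have hd1 : b + d ≤ 1 := by linarith [min_le_left 1 (b + h)]
  have hdeq : b ≤ 3 / 4 → d = h := fun hb => by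
    rw [min_eq_right (by linarith)] at hbd
    linarith
  rw [hbd, add_sub_cancel_left, abs_of_nonneg hd0, abs_of_nonneg (by linarith [ha'.2] : 0 ≤ 1 - a')]
  have hmove : 2 * h * (1 - a) + (1 - 2 * h) * (|a - (b + d)| - |a - b|) ≤
      2 * h * (1 - a') + |a' - a| + (1 - 2 * h) * (|a' - (b + d)| - |a - b|) := by
    have h₁ : |a - (b + d)| ≤ |a' - a| + |a' - (b + d)| := by
      rw [abs_sub_comm a' a]
      exact abs_sub_le _ _ _
    have h₂ : a' - a ≤ |a' - a| := le_abs_self _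
    nlinarith [mul_le_mul_of_nonneg_left h₁ (by linarith : 0 ≤ 1 - 2 * h)]
  refine le_trans ?_ (add_le_add_left hmove _)
  have hpow : h ^ 3 ≤ h ^ 2 / 4 := by nlinarith [sq_nonneg h]
  have habs : d - 2 * max (a - b) 0 ≤ |a - (b + d)| - |a - b| := by
    rcases le_total a b with hle | hle
    · rw [max_eq_right (by linarith), abs_of_nonpos (by linarith : a - b ≤ 0)]
      linarith [neg_le_abs (a - (b + d))]
    · rw [max_eq_left (by linarith), abs_of_nonneg (by linarith : 0 ≤ a - b)]
      linarith [neg_le_abs (a - (b + d))]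
  have habs' := mul_le_mul_of_nonneg_left habs (by linarith : 0 ≤ 1 - 2 * h)
  rcases le_or_gt b (3 / 4) with hb | hb
  · obtain rfl := hdeq hb
    have hm : max (a - b) 0 ≤ d ^ 2 := max_le (by nlinarith [sq_nonneg d]) (sq_nonneg d)
    have hm0 : 0 ≤ max (a - b) 0 := le_max_right _ _
    have hab' : a - b ≤ d ^ 2 := (le_max_left _ _).trans hm
    nlinarith [mul_le_mul_of_nonneg_left hab' h0.le, mul_nonneg h0.le hm0]
  · have hgap : h ^ 2 / 2 ≤ b - a := by nlinarith [sq_nonneg h]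
    rw [max_eq_right (by nlinarith [sq_nonneg h])] at habs'
    nlinarith [mul_le_mul_of_nonneg_left hgap h0.le, mul_nonneg hd0 h0.le, sq_nonneg d,
      mul_nonneg (sub_nonneg.2 hdh) (sub_nonneg.2 hb1)]

/-- The adversary's move at time `t + 1`: the request `f` and the reference point `b'`, given the
algorithm's state `a` and the reference point `b`. -/
def AdversaryMove (h a b : ℝ) (f : ℝ → ℝ) (b' : ℝ) : Prop :=
  (a ≤ b + h ^ 2 * (1 - 2 * b) ∧ f = (fun x => 2 * h * |1 - x|) ∧ b' = min 1 (b + h)) ∨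
  (b + h ^ 2 * (1 - 2 * b) ≤ a ∧ f = (fun x => 2 * h * |x|) ∧ b' = max 0 (b - h))

theorem exists_adversaryMove (h a b : ℝ) : ∃ p : (ℝ → ℝ) × ℝ, AdversaryMove h a b p.1 p.2 := by
  rcases le_total a (b + h ^ 2 * (1 - 2 * b)) with hab | hab
  · exact ⟨(_, _), .inl ⟨hab, rfl, rfl⟩⟩
  · exact ⟨(_, _), .inr ⟨hab, rfl, rfl⟩⟩

theorem AdversaryMove.mem_Icc {h a b b' : ℝ} {f : ℝ → ℝ} (H : AdversaryMove h a b f b')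
    (h0 : 0 < h) (hb : b ∈ Set.Icc (0 : ℝ) 1) : b' ∈ Set.Icc (0 : ℝ) 1 := by
  rcases H with ⟨-, -, rfl⟩ | ⟨-, -, rfl⟩
  · exact ⟨le_min zero_le_one (by linarith [hb.1]), min_le_left _ _⟩
  · exact ⟨le_max_left _ _, max_le zero_le_one (by linarith [hb.2])⟩

theorem one_sub_max_zero_sub (b h : ℝ) : max 0 (b - h) = 1 - min 1 (1 - b + h) := by
  rcases le_total b h with hbh | hbh
  · rw [max_eq_left (by linarith), min_eq_left (by linarith)]
    ring
  · rw [max_eq_right (by linarith), min_eq_right (by linarith)]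
    ring

theorem AdversaryMove.amortized {h a a' b b' : ℝ} {f : ℝ → ℝ} (H : AdversaryMove h a b f b')
    (h0 : 0 < h) (h4 : h ≤ 1 / 4) (ha' : a' ∈ Set.Icc (0 : ℝ) 1) (hb : b ∈ Set.Icc (0 : ℝ) 1) :
    (2 - 6 * h) * |b' - b| + h ^ 3 ≤
      f a' + |a' - a| + (1 - 2 * h) * (|a' - b'| - |a - b|) + ((b' ^ 2 - b') - (b ^ 2 - b)) := by
  rcases H with ⟨hab, rfl, rfl⟩ | ⟨hab, rfl, rfl⟩
  · exact amortized_step h0 h4 ha' hb hab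
  · have key := amortized_step (a := 1 - a) (a' := 1 - a') (b := 1 - b) h0 h4
      ⟨by linarith [ha'.2], by linarith [ha'.1]⟩ ⟨by linarith [hb.2], by linarith [hb.1]⟩
      (by linarith)
    rw [one_sub_max_zero_sub]
    generalize min 1 (1 - b + h) = m at key ⊢
    have e₁ : |m - (1 - b)| = |1 - m - b| := by rw [← abs_neg]; congr 1; ring
    have e₂ : |1 - a' - (1 - a)| = |a' - a| := by rw [← abs_neg]; congr 1; ring
    have e₃ : |1 - a' - m| = |a' - (1 - m)| := by rw [← abs_neg]; congr 1; ring
    have e₄ : |1 - a - (1 - b)| = |a - b| := by rw [← abs_neg]; congr 1; ring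
    rw [e₁, e₂, e₃, e₄, sub_sub_cancel] at key
    linarith

/-- The adversary's strategy against `A` yields a request sequence with its reference points. -/
theorem exists_adversary (A : List (ℝ → ℝ) → ℝ) (h : ℝ) :
    ∃ (f : ℕ → ℝ → ℝ) (b : ℕ → ℝ), b 0 = 0 ∧
      ∀ t, AdversaryMove h (A ((List.range t).map fun i => f (i + 1))) (b t) (f (t + 1))
        (b (t + 1)) := by
  choose p hp using exists_adversaryMove h
  let s : ℕ → List (ℝ → ℝ) × ℝ := fun t => Nat.rec ([], 0)
    (fun _ q => (q.1 ++ [(p (A q.1) q.2).1], (p (A q.1) q.2).2)) t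
  let f : ℕ → ℝ → ℝ := fun t => (p (A (s (t - 1)).1) (s (t - 1)).2).1
  have hs : ∀ t, (s t).1 = (List.range t).map fun i => f (i + 1) := by
    intro t
    induction t with
    | zero => rfl
    | succ t ih =>
      rw [List.range_succ, List.map_append, ← ih]
      rfl
  refine ⟨f, fun t => (s t).2, rfl, fun t => ?_⟩
  rw [← hs]
  exact hp _ _

section Adversary

variable {h : ℝ} {a b : ℕ → ℝ} {f : ℕ → ℝ → ℝ}

theorem reference_mem_Icc (h0 : 0 < h) (hb0 : b 0 = 0)
    (H : ∀ t, AdversaryMove h (a t) (b t) (f (t + 1)) (b (t + 1))) (t : ℕ) :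
    b t ∈ Set.Icc (0 : ℝ) 1 := by
  induction t with
  | zero => simp [hb0]
  | succ t ih => exact (H t).mem_Icc h0 ih

theorem adversary_reachable (h0 : 0 < h) (hb0 : b 0 = 0)
    (H : ∀ t, AdversaryMove h (a t) (b t) (f (t + 1)) (b (t + 1))) (t : ℕ) :
    Reachable f t 0 (∑ i ∈ Finset.range t, |b (i + 1) - b i| + b t) ∧
      Reachable f t 1 (∑ i ∈ Finset.range t, |b (i + 1) - b i| + (1 - b t)) := by
  induction t with
  | zero => simpa [hb0] using
      And.intro (Reachable.zero (f := f) (x := 0) (by simp)) (Reachable.zero (x := 1) (by simp))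
  | succ t ih =>
    obtain ⟨r₀, r₁⟩ := ih
    have hm₀ : (0 : ℝ) ∈ Set.Icc (0 : ℝ) 1 := by simp
    have hm₁ : (1 : ℝ) ∈ Set.Icc (0 : ℝ) 1 := by simp
    obtain ⟨hbt0, hbt1⟩ := reference_mem_Icc h0 hb0 H t
    rw [Finset.sum_range_succ]
    rcases H t with ⟨-, hf, hb⟩ | ⟨-, hf, hb⟩
    · have hle : b t ≤ b (t + 1) := hb ▸ le_min hbt1 (by linarith)
      rw [abs_of_nonneg (by linarith : 0 ≤ b (t + 1) - b t)]
      refine ⟨?_, r₁.succ hm₁ (by simp [hf]; linarith)⟩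
      rcases le_total 1 (b t + h) with hc | hc
      · rw [min_eq_left hc] at hb
        exact r₁.succ hm₀ (by simp [hf, hb])
      · rw [min_eq_right hc] at hb
        exact r₀.succ hm₀ (by simp [hf, hb]; linarith)
    · have hle : b (t + 1) ≤ b t := hb ▸ max_le hbt0 (by linarith)
      rw [abs_of_nonpos (by linarith : b (t + 1) - b t ≤ 0)]
      refine ⟨r₀.succ hm₀ (by simp [hf]; linarith), ?_⟩
      rcases le_total (b t - h) 0 with hc | hc
      · rw [max_eq_left hc] at hb
        exact r₀.succ hm₁ (by simp [hf, hb])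
      · rw [max_eq_right hc] at hb
        exact r₁.succ hm₁ (by simp [hf, hb]; linarith)

theorem adversary_cost_lower_bound (h0 : 0 < h) (h4 : h ≤ 1 / 4) (hb0 : b 0 = 0) (ha0 : a 0 = 0)
    (ha : ∀ t, a t ∈ Set.Icc (0 : ℝ) 1)
    (H : ∀ t, AdversaryMove h (a t) (b t) (f (t + 1)) (b (t + 1))) (T : ℕ) :
    (2 - 6 * h) * ∑ i ∈ Finset.range T, |b (i + 1) - b i| + h ^ 3 * T ≤
      ∑ i ∈ Finset.Icc 1 T, f i (a i) + ∑ i ∈ Finset.Icc 1 T, |a i - a (i - 1)|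
        + (1 - 2 * h) * |a T - b T| + (b T ^ 2 - b T) := by
  induction T with
  | zero => simp [hb0, ha0]
  | succ t ih =>
    have key := (H t).amortized h0 h4 (ha (t + 1)) (reference_mem_Icc h0 hb0 H t)
    rw [Finset.sum_range_succ, Finset.sum_Icc_succ_top (by omega),
      Finset.sum_Icc_succ_top (by omega), Nat.add_sub_cancel]
    push_cast
    linarith

end Adversary

/-- No deterministic online algorithm has competitive ratio `< 2`
for the continuous data-center optimization problem: for every deterministic online
algorithm `A` (mapping the list of revealed cost functions to a state in `[0,1]`),
every `c < 2` and every `α ≥ 0` there is an instance, built from functions of the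
form `x ↦ ε·|x|` and `x ↦ ε·|1 − x|`, on which the schedule `X^A` produced by `A`
(where `x^A_t = A [f_1, …, f_t]`) satisfies `C(X^A) > c·C(X*) + α` for every optimal
fractional schedule `X*`. -/
theorem stmt18 (A : List (ℝ → ℝ) → ℝ) (hA : ∀ l, A l ∈ Set.Icc (0 : ℝ) 1)
    (c : ℝ) (hc : c < 2) (α : ℝ) (hα : 0 ≤ α) :
    ∃ (T : ℕ) (f : ℕ → ℝ → ℝ),
      (∀ t ∈ Finset.Icc 1 T, ∃ ε : ℝ, 0 < ε ∧
        ((f t = fun x => ε * |x|) ∨ (f t = fun x => ε * |1 - x|))) ∧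
      ∀ xA : ℕ → ℝ,
        (xA 0 = 0 ∧ xA (T + 1) = 0 ∧
          ∀ t ∈ Finset.Icc 1 T,
            xA t = A ((List.range t).map fun i => f (i + 1))) →
        ∀ xstar : ℕ → ℝ, Feasible18 T xstar →
          (∀ y : ℕ → ℝ, Feasible18 T y → Cost18 T f xstar ≤ Cost18 T f y) →
          c * Cost18 T f xstar + α < Cost18 T f xA := by
  obtain ⟨h, h0, h4, hch⟩ : ∃ h : ℝ, 0 < h ∧ h ≤ 1 / 4 ∧ c ≤ 2 - 6 * h := by
    refine ⟨min (1 / 4) ((2 - c) / 6), lt_min (by norm_num) (by linarith), min_le_left _ _, ?_⟩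
    linarith [min_le_right (1 / 4) ((2 - c) / 6)]
  obtain ⟨T, hT⟩ := exists_nat_gt ((3 + α) / h ^ 3)
  rw [div_lt_iff₀ (by positivity)] at hT
  let A' : List (ℝ → ℝ) → ℝ := fun l => if l = [] then 0 else A l
  have hA' : ∀ l, A' l ∈ Set.Icc (0 : ℝ) 1 := fun l => by
    by_cases hl : l = []
    · simp [A', hl]
    · simpa only [A', if_neg hl] using hA l
  obtain ⟨f, b, hb0, H⟩ := exists_adversary A' h
  set a : ℕ → ℝ := fun t => A' ((List.range t).map fun i => f (i + 1)) with ha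
  have hf : ∀ t ∈ Finset.Icc 1 T, ∃ ε : ℝ, 0 < ε ∧
      ((f t = fun x => ε * |x|) ∨ (f t = fun x => ε * |1 - x|)) := fun t ht => by
    obtain ⟨s, rfl⟩ := Nat.exists_eq_add_of_le' (Finset.mem_Icc.1 ht).1
    refine ⟨2 * h, by linarith, ?_⟩
    rcases H s with ⟨-, hs, -⟩ | ⟨-, hs, -⟩
    exacts [.inr hs, .inl hs]
  refine ⟨T, f, hf, ?_⟩
  rintro x ⟨hx0, -, hx⟩ z - hopt
  have hxa : ∀ t ≤ T, x t = a t := fun t ht => by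
    rcases Nat.eq_zero_or_pos t with rfl | hpos
    · simp [hx0, ha, A']
    · rw [hx t (Finset.mem_Icc.2 ⟨hpos, ht⟩)]
      simp [ha, A', hpos.ne']
  have halg := adversary_cost_lower_bound (a := a) h0 h4 hb0 (by simp [ha, A']) (fun t => hA' _) H T
  have hxcost : ∑ i ∈ Finset.Icc 1 T, f i (a i) + ∑ i ∈ Finset.Icc 1 T, |a i - a (i - 1)|
      ≤ Cost18 T f x := by
    rw [Cost18, Finset.sum_Icc_succ_top (by omega), div_self two_ne_zero, one_mul]
    have e₁ : ∑ i ∈ Finset.Icc 1 T, f i (x i) = ∑ i ∈ Finset.Icc 1 T, f i (a i) :=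
      Finset.sum_congr rfl fun i hi => by rw [hxa i (Finset.mem_Icc.1 hi).2]
    have e₂ : ∑ i ∈ Finset.Icc 1 T, |x i - x (i - 1)| = ∑ i ∈ Finset.Icc 1 T, |a i - a (i - 1)| :=
      Finset.sum_congr rfl fun i hi => by
        have := (Finset.mem_Icc.1 hi).2
        rw [hxa i this, hxa (i - 1) (by omega)]
    linarith [abs_nonneg (x (T + 1) - x (T + 1 - 1))]
  obtain ⟨y, hy0, hyT, hy, hyv⟩ := (adversary_reachable h0 hb0 H T).1
  have hz : Cost18 T f z ≤ ∑ i ∈ Finset.range T, |b (i + 1) - b i| + b T := by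
    refine (hopt y ⟨hy0, hyT, hy⟩).trans ?_
    rwa [Cost18, div_self two_ne_zero, one_mul]
  have hz0 : 0 ≤ Cost18 T f z := by
    refine add_nonneg (Finset.sum_nonneg fun t ht => ?_)
      (mul_nonneg (by norm_num) (Finset.sum_nonneg fun t _ => abs_nonneg _))
    obtain ⟨ε, hε, h' | h'⟩ := hf t ht <;> rw [h'] <;> positivity
  obtain ⟨hbT0, hbT1⟩ := reference_mem_Icc h0 hb0 H T
  have hdist : |a T - b T| ≤ 1 := by
    obtain ⟨h₁, h₂⟩ := hA' ((List.range T).map fun i => f (i + 1))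
    exact abs_sub_le_iff.2 ⟨by linarith [show a T ≤ 1 from h₂], by linarith [show 0 ≤ a T from h₁]⟩
  have hcz : c * Cost18 T f z ≤ (2 - 6 * h) * Cost18 T f z := mul_le_mul_of_nonneg_right hch hz0
  have hcz' := mul_le_mul_of_nonneg_left hz (by linarith : 0 ≤ 2 - 6 * h)
  nlinarith [mul_le_mul_of_nonneg_left hdist (by linarith : 0 ≤ 1 - 2 * h), mul_nonneg h0.le hbT0]
end
end
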